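/- Let R̂ be a Hecke R-matrix for the parameter q with m_q ≠ 0 for all m ≥ 1, let F̂ be a closed R-matrix compatible with R̂, and let M be a matrix of generators of M(R̂,F̂). Then for every k ≥ 1 and 0 ≤ i ≤ k−1, the following identity of N×N matrices over A holds: M^{‾(k−i)} · σ_i(M) = Tr_F(2,…,k)(R̂_{1→k−i−1} A^{(k−i+1,i)} M_{1̄} ⋯ M_{k̄}), where A^{(k−i+1,i)} denotes the q-antisymmetrizer A^{(i)} built from the operators R̂_{k−i+1},…,R̂_{k−1} (i.e. the copy of A^{(i)} acting in the tensor factors k−i+1,…,k). -/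

import Mathlib

/-! Common definitions for quantum matrix algebras `M(R̂,F̂)` in the sense of
Isaev–Ogievetsky–Pyatov, "On quantum matrix algebras satisfying the
Cayley-Hamilton-Newton identities".

We model operators on `V^{⊗m}` (where `dim V = N`) as matrices indexed by
multi-indices `Fin m → Fin N`; entries are taken in a (possibly
noncommutative) unital associative algebra `A` over a field `K`.
Sites (tensor factors) are numbered starting from `0`, so the paper's
`X_i` is `site m (i-1) X`, and the paper's `M_{\overline{k}}` is
`Mbar m F F⁻¹ M (k-1)`. -/

namespace CHN

noncomputable section

/-- Operators on `V^{⊗m}` (`dim V = N`) with entries in a ring `A`. -/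
abbrev Op (N : ℕ) (A : Type*) [Ring A] (m : ℕ) :=
  Matrix (Fin m → Fin N) (Fin m → Fin N) A

/-- Operators on `V ⊗ V`. -/
abbrev M2 (N : ℕ) (A : Type*) [Ring A] :=
  Matrix (Fin N × Fin N) (Fin N × Fin N) A

/-- `site m i X` places the two-site operator `X` at the (0-based) tensor
factors `i, i+1` of `V^{⊗m}`, acting as the identity elsewhere.  In the
paper's 1-based notation, `X_i = site m (i-1) X`.  (Out of range it is the
identity.) -/
def site {A : Type*} [Ring A] {N : ℕ} (m i : ℕ) (X : M2 N A) : Op N A m :=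
  fun a b =>
    if h : i + 1 < m then
      X (a ⟨i, Nat.lt_of_succ_lt h⟩, a ⟨i + 1, h⟩)
          (b ⟨i, Nat.lt_of_succ_lt h⟩, b ⟨i + 1, h⟩) *
        (if ∀ j : Fin m, (j : ℕ) ≠ i → (j : ℕ) ≠ i + 1 → a j = b j then 1 else 0)
    else if a = b then 1 else 0

/-- `site1 m i X` places the one-site operator `X` at the (0-based) factor `i`. -/
def site1 {A : Type*} [Ring A] {N : ℕ} (m i : ℕ) (X : Matrix (Fin N) (Fin N) A) :
    Op N A m :=
  fun a b =>
    if h : i < m then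
      X (a ⟨i, h⟩) (b ⟨i, h⟩) *
        (if ∀ j : Fin m, (j : ℕ) ≠ i → a j = b j then 1 else 0)
    else if a = b then 1 else 0

/-- `chain m X i l = X_i X_{i+1} ⋯ X_{i+l-1}` (0-based sites, `l` factors); in
the paper's 1-based notation this is `X_{i+1 → i+l}`. -/
def chain {A : Type*} [Ring A] {N : ℕ} (m : ℕ) (X : M2 N A) (i : ℕ) :
    ℕ → Op N A m
  | 0 => 1
  | l + 1 => chain m X i l * site m (i + l) X

/-- The Yang–Baxter equation `X₁X₂X₁ = X₂X₁X₂` on `V^{⊗3}`. -/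
def YB {A : Type*} [Ring A] {N : ℕ} (X : M2 N A) : Prop :=
  site 3 0 X * site 3 1 X * site 3 0 X = site 3 1 X * site 3 0 X * site 3 1 X

/-- Compatibility of a pair of R-matrices: both Yang–Baxter equations together
with the conditions `R̂₁F̂₂F̂₁ = F̂₂F̂₁R̂₂` and `F̂₁F̂₂R̂₁ = R̂₂F̂₁F̂₂` on `V^{⊗3}`. -/
def Compatible {A : Type*} [Ring A] {N : ℕ} (R F : M2 N A) : Prop :=
  YB R ∧ YB F ∧
    site 3 0 R * site 3 1 F * site 3 0 F = site 3 1 F * site 3 0 F * site 3 1 R ∧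
    site 3 0 F * site 3 1 F * site 3 0 R = site 3 1 R * site 3 0 F * site 3 1 F

/-- `Ψ` witnesses closedness of `F̂`:  `Ψ^{af}_{cg} F̂^{gb}_{fd} = δ^a_d δ^b_c`. -/
def IsClosedPair {A : Type*} [Ring A] {N : ℕ} (F Ψ : M2 N A) : Prop :=
  ∀ a b c d : Fin N,
    (∑ f : Fin N, ∑ g : Fin N, Ψ (a, f) (c, g) * F (g, b) (f, d)) =
      if a = d ∧ b = c then 1 else 0

/-- The matrix `D`, `D^a_b := Ψ^{ac}_{bc}`. -/
def Dmat {A : Type*} [Ring A] {N : ℕ} (Ψ : M2 N A) : Matrix (Fin N) (Fin N) A :=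
  fun a b => ∑ c : Fin N, Ψ (a, c) (b, c)

/-- Quantum trace (with weight `D`) over the last tensor factor. -/
def qtr1 {K : Type*} [Field K] {A : Type*} [Ring A] [Algebra K A] {N m : ℕ}
    (D : Matrix (Fin N) (Fin N) K) (X : Op N A (m + 1)) : Op N A m :=
  fun a b => ∑ c : Fin N, ∑ e : Fin N,
    algebraMap K A (D c e) * X (Fin.snoc a e) (Fin.snoc b c)

/-- Quantum trace over the last `j` tensor factors. -/
def qtrs {K : Type*} [Field K] {A : Type*} [Ring A] [Algebra K A] {N : ℕ}
    (D : Matrix (Fin N) (Fin N) K) (m : ℕ) :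
    (j : ℕ) → Op N A (m + j) → Op N A m
  | 0, X => X
  | j + 1, X => qtrs D m j (qtr1 D X)

/-- Full quantum trace `Tr_F(1,…,m)`, with values in `A`. -/
def qtrAll {K : Type*} [Field K] {A : Type*} [Ring A] [Algebra K A] {N m : ℕ}
    (D : Matrix (Fin N) (Fin N) K) (X : Op N A m) : A :=
  ∑ a : Fin m → Fin N, ∑ b : Fin m → Fin N,
    algebraMap K A (∏ i, D (a i) (b i)) * X b a

/-- Quantum trace of a one-site operator:  `Tr_F X = Tr (D X)`. -/
def trF {K : Type*} [Field K] {A : Type*} [Ring A] [Algebra K A] {N : ℕ}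
    (D : Matrix (Fin N) (Fin N) K) (X : Matrix (Fin N) (Fin N) A) : A :=
  ∑ a : Fin N, ∑ b : Fin N, algebraMap K A (D a b) * X b a

/-- Ordinary partial trace over the last tensor factor. -/
def ptr1 {A : Type*} [Ring A] {N m : ℕ} (X : Op N A (m + 1)) : Op N A m :=
  fun a b => ∑ c : Fin N, X (Fin.snoc a c) (Fin.snoc b c)

/-- Ordinary partial trace over the last `j` tensor factors. -/
def ptrs {A : Type*} [Ring A] {N : ℕ} (m : ℕ) :
    (j : ℕ) → Op N A (m + j) → Op N A m
  | 0, X => X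
  | j + 1, X => ptrs m j (ptr1 X)

/-- `Mbar m F Finv M k` is the paper's `M_{\overline{k+1}}` (0-based index `k`):
`M_{\overline{1}} := M₁` and `M_{\overline{k+1}} := F̂_k M_{\overline{k}} F̂_k⁻¹`. -/
def Mbar {A : Type*} [Ring A] {N : ℕ} (m : ℕ) (F Finv : M2 N A)
    (M : Matrix (Fin N) (Fin N) A) : ℕ → Op N A m
  | 0 => site1 m 0 M
  | k + 1 => site m k F * Mbar m F Finv M k * site m k Finv

/-- `MbarSeg m F Finv M i l = M_{\overline{i+1}} M_{\overline{i+2}} ⋯ M_{\overline{i+l}}`,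
the ordered product of `l` consecutive copies starting at 0-based index `i`.
In particular `MbarSeg m F Finv M 0 k = M_{\overline{1}} ⋯ M_{\overline{k}}`. -/
def MbarSeg {A : Type*} [Ring A] {N : ℕ} (m : ℕ) (F Finv : M2 N A)
    (M : Matrix (Fin N) (Fin N) A) (i : ℕ) : ℕ → Op N A m
  | 0 => 1
  | l + 1 => MbarSeg m F Finv M i l * Mbar m F Finv M (i + l)

/-- The double twist `R̂^{FF} = F̂ (F̂ R̂ F̂⁻¹) F̂⁻¹`. -/
def RFF {K : Type*} [Field K] {N : ℕ} (R F : M2 N K) : M2 N K :=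
  F * (F * R * F⁻¹) * F⁻¹

/-- `M` is a matrix of generators of the algebra `M(R̂,F̂)`:
`R̂₁ M_{\overline{1}} M_{\overline{2}} = M_{\overline{1}} M_{\overline{2}} (R̂^{FF})₁`
on `V ⊗ V`. -/
def IsGenerators {K : Type*} [Field K] {A : Type*} [Ring A] [Algebra K A] {N : ℕ}
    (R F : M2 N K) (M : Matrix (Fin N) (Fin N) A) : Prop :=
  site 2 0 (R.map (algebraMap K A)) *
      MbarSeg 2 (F.map (algebraMap K A)) ((F⁻¹).map (algebraMap K A)) M 0 2 =
    MbarSeg 2 (F.map (algebraMap K A)) ((F⁻¹).map (algebraMap K A)) M 0 2 *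
      site 2 0 ((RFF R F).map (algebraMap K A))

/-- Evaluation of a noncommutative polynomial `Y` in `v` variables, substituting
for the variable `x_j` the operator `R̂` placed at the (0-based) sites
`p+j, p+j+1` of `V^{⊗m}`.  For `p = 0` this is the paper's
`Y^{(v+1)} = Y^{(v+1)}(R̂₁,…,R̂_v)`, and a general `p` gives `Y^{(p+1,v+1)}`. -/
def evalY {K : Type*} [Field K] {A : Type*} [Ring A] [Algebra K A] {N m v : ℕ}
    (R : M2 N A) (p : ℕ) (Y : FreeAlgebra K (Fin v)) : Op N A m :=
  FreeAlgebra.lift K (fun j : Fin v => site m (p + (j : ℕ)) R) Y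

/-- `Ustack m R k l = R̂_{l → l+k-1} ⋯ R̂_{2 → k+1} R̂_{1 → k}` (1-based labels):
the product of `l` descending chains of length `k`. -/
def Ustack {A : Type*} [Ring A] {N : ℕ} (m : ℕ) (R : M2 N A) (k : ℕ) :
    ℕ → Op N A m
  | 0 => 1
  | l + 1 => chain m R l k * Ustack m R k l

/-- The `q`-number `n_q = (qⁿ − q⁻ⁿ)/(q − q⁻¹)`. -/
def qInt {K : Type*} [Field K] (q : K) (n : ℕ) : K :=
  (q ^ n - q⁻¹ ^ n) / (q - q⁻¹)

/-- `R̂` is a Hecke R-matrix for the parameter `q`:  it is invertible, satisfies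
the Yang–Baxter equation and the Hecke condition `R̂² = 1 + (q − q⁻¹)R̂`. -/
def IsHecke {K : Type*} [Field K] {N : ℕ} (q : K) (R : M2 N K) : Prop :=
  IsUnit R ∧ YB R ∧ R * R = 1 + (q - q⁻¹) • R

/-- The `q`-antisymmetrizer `A^{(k)}` built from `R̂`, placed at the (0-based)
tensor factors `p, p+1, …, p+k-1` of `V^{⊗m}`. -/
def qasym {K : Type*} [Field K] {N : ℕ} (q : K) (R : M2 N K) (m p : ℕ) :
    ℕ → Op N K m
  | 0 => 1
  | 1 => 1
  | k + 2 =>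
      (qInt q (k + 2))⁻¹ •
        (qasym q R m p (k + 1) *
          (q ^ (k + 1) • (1 : Op N K m) - qInt q (k + 1) • site m (p + k) R) *
          qasym q R m p (k + 1))

/-- The `q`-symmetrizer `S^{(k)}` built from `R̂`, placed at the (0-based)
tensor factors `p, p+1, …, p+k-1` of `V^{⊗m}`. -/
def qsym {K : Type*} [Field K] {N : ℕ} (q : K) (R : M2 N K) (m p : ℕ) :
    ℕ → Op N K m
  | 0 => 1
  | 1 => 1
  | k + 2 =>
      (qInt q (k + 2))⁻¹ •
        (qsym q R m p (k + 1) *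
          (q⁻¹ ^ (k + 1) • (1 : Op N K m) + qInt q (k + 1) • site m (p + k) R) *
          qsym q R m p (k + 1))

/-- The elementary symmetric function
`σ_k(M) = Tr_F(1,…,k)(A^{(k)} M_{\overline{1}}⋯M_{\overline{k}})` (with `σ_0 = 1`). -/
def sigmaF {K : Type*} [Field K] {A : Type*} [Ring A] [Algebra K A] {N : ℕ}
    (q : K) (R F Ψ : M2 N K) (M : Matrix (Fin N) (Fin N) A) (k : ℕ) : A :=
  qtrAll (Dmat Ψ)
    ((qasym q R k 0 k).map (algebraMap K A) *
      MbarSeg k (F.map (algebraMap K A)) ((F⁻¹).map (algebraMap K A)) M 0 k)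

/-- The complete symmetric function
`τ_k(M) = Tr_F(1,…,k)(S^{(k)} M_{\overline{1}}⋯M_{\overline{k}})` (with `τ_0 = 1`). -/
def tauF {K : Type*} [Field K] {A : Type*} [Ring A] [Algebra K A] {N : ℕ}
    (q : K) (R F Ψ : M2 N K) (M : Matrix (Fin N) (Fin N) A) (k : ℕ) : A :=
  qtrAll (Dmat Ψ)
    ((qsym q R k 0 k).map (algebraMap K A) *
      MbarSeg k (F.map (algebraMap K A)) ((F⁻¹).map (algebraMap K A)) M 0 k)

/-- The power sums `s_k(M) = Tr_F(1,…,k)(R̂_{1→k−1} M_{\overline{1}}⋯M_{\overline{k}})`,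
with `s_0 = 1`. -/
def sF {K : Type*} [Field K] {A : Type*} [Ring A] [Algebra K A] {N : ℕ}
    (R F Ψ : M2 N K) (M : Matrix (Fin N) (Fin N) A) : ℕ → A
  | 0 => 1
  | j + 1 =>
      qtrAll (Dmat Ψ)
        (chain (j + 1) (R.map (algebraMap K A)) 0 j *
          MbarSeg (j + 1) (F.map (algebraMap K A)) ((F⁻¹).map (algebraMap K A)) M 0 (j + 1))

/-- The `(j+1)`-st quantum power of `M`,
`M^{\overline{j+1}} = Tr_F(2,…,j+1)(R̂_{1→j} M_{\overline{1}}⋯M_{\overline{j+1}})`,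
as a one-site operator (so `MpowF R F Ψ M 0 = M₁ = M`). -/
def MpowF {K : Type*} [Field K] {A : Type*} [Ring A] [Algebra K A] {N : ℕ}
    (R F Ψ : M2 N K) (M : Matrix (Fin N) (Fin N) A) (j : ℕ) : Op N A 1 :=
  qtrs (Dmat Ψ) 1 j
    (chain (1 + j) (R.map (algebraMap K A)) 0 j *
      MbarSeg (1 + j) (F.map (algebraMap K A)) ((F⁻¹).map (algebraMap K A)) M 0 (j + 1))

/-- The `(j+1)`-st wedge power of `M`,
`M^{∧(j+1)} = Tr_F(2,…,j+1)(A^{(j+1)} M_{\overline{1}}⋯M_{\overline{j+1}})`. -/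
def MwedgeF {K : Type*} [Field K] {A : Type*} [Ring A] [Algebra K A] {N : ℕ}
    (q : K) (R F Ψ : M2 N K) (M : Matrix (Fin N) (Fin N) A) (j : ℕ) : Op N A 1 :=
  qtrs (Dmat Ψ) 1 j
    ((qasym q R (1 + j) 0 (j + 1)).map (algebraMap K A) *
      MbarSeg (1 + j) (F.map (algebraMap K A)) ((F⁻¹).map (algebraMap K A)) M 0 (j + 1))

/-- The `(j+1)`-st symmetric power of `M`,
`M^{S(j+1)} = Tr_F(2,…,j+1)(S^{(j+1)} M_{\overline{1}}⋯M_{\overline{j+1}})`. -/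
def MsymF {K : Type*} [Field K] {A : Type*} [Ring A] [Algebra K A] {N : ℕ}
    (q : K) (R F Ψ : M2 N K) (M : Matrix (Fin N) (Fin N) A) (j : ℕ) : Op N A 1 :=
  qtrs (Dmat Ψ) 1 j
    ((qsym q R (1 + j) 0 (j + 1)).map (algebraMap K A) *
      MbarSeg (1 + j) (F.map (algebraMap K A)) ((F⁻¹).map (algebraMap K A)) M 0 (j + 1))

/-- `M^{\overline{0}} := q^{-n} n_q Tr_{(2,…,n)}(A^{(n)}) D^{-1}`, with `n = n0 + 1`
(an ordinary, non-quantum, trace over the factors `2,…,n`). -/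
def MzeroF {K : Type*} [Field K] {N : ℕ} (q : K) (R Ψ : M2 N K) (n0 : ℕ) :
    Op N K 1 :=
  (q⁻¹ ^ (n0 + 1) * qInt q (n0 + 1)) •
    (ptrs 1 n0 (qasym q R (1 + n0) 0 (n0 + 1)) * site1 1 0 ((Dmat Ψ)⁻¹))

/-- The generators of the characteristic subalgebra: all elements
`α(Y^{(k)}) = Tr_F(1,…,k)(Y^{(k)} M_{\overline{1}}⋯M_{\overline{k}})`, `k ≥ 1`. -/
def charSet {K : Type*} [Field K] {A : Type*} [Ring A] [Algebra K A] {N : ℕ}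
    (R F Ψ : M2 N K) (M : Matrix (Fin N) (Fin N) A) : Set A :=
  { x : A | ∃ (v : ℕ) (Y : FreeAlgebra K (Fin v)),
      x = qtrAll (Dmat Ψ)
        (evalY (R.map (algebraMap K A)) 0 Y *
          MbarSeg (v + 1) (F.map (algebraMap K A)) ((F⁻¹).map (algebraMap K A)) M 0 (v + 1)) }

end

section Extension

variable {A : Type*} [Ring A] {N : ℕ}

/-- The operator `X ⊗ 1` obtained by adding a tensor factor on the right. -/
def extRight {m : ℕ} (X : Op N A m) : Op N A (m + 1) :=
  fun a b => X (Fin.init a) (Fin.init b) * if a (Fin.last m) = b (Fin.last m) then 1 else 0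

/-- The operator `1 ⊗ X` obtained by adding a tensor factor on the left. -/
def extLeft {m : ℕ} (X : Op N A m) : Op N A (m + 1) :=
  fun a b => X (Fin.tail a) (Fin.tail b) * if a 0 = b 0 then 1 else 0

lemma sum_snoc {B : Type*} [AddCommMonoid B] {m : ℕ} (f : (Fin (m + 1) → Fin N) → B) :
    ∑ x, f x = ∑ y : Fin m → Fin N, ∑ c : Fin N, f (Fin.snoc y c) := by
  rw [← (Fin.snocEquiv fun _ => Fin N).sum_comp, Fintype.sum_prod_type, Finset.sum_comm]
  rfl

lemma sum_cons {B : Type*} [AddCommMonoid B] {m : ℕ} (f : (Fin (m + 1) → Fin N) → B) :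
    ∑ x, f x = ∑ c : Fin N, ∑ y : Fin m → Fin N, f (Fin.cons c y) := by
  rw [← (Fin.consEquiv fun _ => Fin N).sum_comp, Fintype.sum_prod_type]
  rfl

@[simp]
lemma extRight_snoc {m : ℕ} (X : Op N A m) (a b : Fin m → Fin N) (s t : Fin N) :
    extRight X (Fin.snoc a s) (Fin.snoc b t) = X a b * if s = t then 1 else 0 := by
  simp [extRight]

@[simp]
lemma extLeft_cons {m : ℕ} (X : Op N A m) (a b : Fin m → Fin N) (s t : Fin N) :
    extLeft X (Fin.cons s a) (Fin.cons t b) = X a b * if s = t then 1 else 0 := by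
  simp [extLeft]

lemma ext_snoc {m : ℕ} {X Y : Op N A (m + 1)}
    (h : ∀ a s b t, X (Fin.snoc a s) (Fin.snoc b t) = Y (Fin.snoc a s) (Fin.snoc b t)) :
    X = Y := by
  ext a b
  rw [← Fin.snoc_init_self a, ← Fin.snoc_init_self b]
  exact h _ _ _ _

lemma ext_cons {m : ℕ} {X Y : Op N A (m + 1)}
    (h : ∀ s a t b, X (Fin.cons s a) (Fin.cons t b) = Y (Fin.cons s a) (Fin.cons t b)) :
    X = Y := by
  ext a b
  rw [← Fin.cons_self_tail a, ← Fin.cons_self_tail b]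
  exact h _ _ _ _

lemma extRight_mul {m : ℕ} (X Y : Op N A m) : extRight (X * Y) = extRight X * extRight Y := by
  refine ext_snoc fun a s b t => ?_
  simp only [extRight_snoc, Matrix.mul_apply, sum_snoc]
  split_ifs with hst <;> simp [hst]

lemma extLeft_mul {m : ℕ} (X Y : Op N A m) : extLeft (X * Y) = extLeft X * extLeft Y := by
  refine ext_cons fun s a t b => ?_
  rw [Matrix.mul_apply, sum_cons, Finset.sum_comm]
  simp only [extLeft_cons, Matrix.mul_apply]
  split_ifs with hst <;> simp [hst]

lemma extRight_smul_one {m : ℕ} (x : A) : extRight (x • (1 : Op N A m)) = x • 1 := by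
  refine ext_snoc fun a s b t => ?_
  simp only [extRight_snoc, Matrix.smul_apply, Matrix.one_apply, Fin.snoc_inj]
  by_cases h1 : a = b <;> by_cases h2 : s = t <;> simp [h1, h2]

lemma extRight_one {m : ℕ} : extRight (1 : Op N A m) = 1 := by
  simpa using extRight_smul_one (N := N) (m := m) (1 : A)

lemma extLeft_one {m : ℕ} : extLeft (1 : Op N A m) = 1 := by
  refine ext_cons fun s a t b => ?_
  simp only [extLeft_cons, Matrix.one_apply, Fin.cons_inj]
  by_cases h1 : a = b <;> by_cases h2 : s = t <;> simp [h1, h2]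

lemma site_of_le {m i : ℕ} (h : m ≤ i + 1) (X : M2 N A) : site m i X = 1 := by
  ext a b
  simp [site, Matrix.one_apply, not_lt.2 h]

lemma site_succ_eq_extRight {m i : ℕ} (h : i + 1 < m) (X : M2 N A) :
    site (m + 1) i X = extRight (site m i X) := by
  refine ext_snoc fun a s b t => ?_
  have h1 : i + 1 < m + 1 := by omega
  have e : ∀ (k : ℕ) (hk : k < m) (hk' : k < m + 1) (c : Fin m → Fin N) (u : Fin N),
      Fin.snoc (α := fun _ => Fin N) c u ⟨k, hk'⟩ = c ⟨k, hk⟩ := fun k hk hk' c u =>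
    Fin.snoc_castSucc (α := fun _ => Fin N) (n := m) u c ⟨k, hk⟩
  have h2 : m ≠ i := by omega
  have h3 : m ≠ i + 1 := by omega
  simp only [extRight_snoc, site, h, h1, dif_pos, e i (by omega), e (i + 1) (by omega),
    Fin.forall_fin_succ', Fin.snoc_castSucc, Fin.snoc_last, Fin.val_castSucc, Fin.val_last,
    mul_assoc]
  congr 1
  by_cases hs : s = t <;> simp [hs, h2, h3]

lemma site_succ_eq_extLeft (m i : ℕ) (X : M2 N A) :
    site (m + 1) (i + 1) X = extLeft (site m i X) := by
  rcases le_or_gt m (i + 1) with h | h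
  · rw [site_of_le h, site_of_le (by omega), extLeft_one]
  refine ext_cons fun s a t b => ?_
  have h1 : i + 1 + 1 < m + 1 := by omega
  have e : ∀ (k : ℕ) (hk : k < m) (hk' : k + 1 < m + 1) (c : Fin m → Fin N) (u : Fin N),
      Fin.cons (α := fun _ => Fin N) u c ⟨k + 1, hk'⟩ = c ⟨k, hk⟩ := fun k hk hk' c u =>
    Fin.cons_succ (α := fun _ => Fin N) (n := m) u c ⟨k, hk⟩
  simp only [extLeft_cons, site, h, h1, dif_pos, e i (by omega), e (i + 1) (by omega),
    Fin.forall_fin_succ, Fin.cons_succ, Fin.cons_zero, Fin.val_succ, Fin.val_zero, mul_assoc]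
  congr 1
  by_cases hs : s = t <;> simp [hs]

lemma site_zero_cons {m : ℕ} (X : M2 N A) (s t u v : Fin N) (a b : Fin m → Fin N) :
    site (m + 2) 0 X (Fin.cons s (Fin.cons t a : Fin (m + 1) → Fin N))
      (Fin.cons u (Fin.cons v b : Fin (m + 1) → Fin N)) =
        X (s, t) (u, v) * if a = b then 1 else 0 := by
  have e : ∀ (c : Fin m → Fin N) (x y : Fin N),
      (Fin.cons x (Fin.cons y c : Fin (m + 1) → Fin N) : Fin (m + 2) → Fin N) 1 = y :=
    fun c x y => rfl
  simp [site, Fin.forall_fin_succ, funext_iff, e]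

lemma site_last_snoc {m : ℕ} (X : M2 N A) (s t u v : Fin N) (a b : Fin m → Fin N) :
    site (m + 2) m X (Fin.snoc (Fin.snoc a s : Fin (m + 1) → Fin N) t)
      (Fin.snoc (Fin.snoc b u : Fin (m + 1) → Fin N) v) =
        X (s, t) (u, v) * if a = b then 1 else 0 := by
  have e1 : ∀ (c : Fin m → Fin N) (x y : Fin N) (h : m < m + 2),
      (Fin.snoc (Fin.snoc c x : Fin (m + 1) → Fin N) y : Fin (m + 2) → Fin N) ⟨m, h⟩ = x :=
    fun c x y h => by
      have := Fin.snoc_castSucc (α := fun _ => Fin N) (n := m + 1) y (Fin.snoc c x) (Fin.last m)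
      rwa [Fin.snoc_last] at this
  have e2 : ∀ (c : Fin m → Fin N) (x y : Fin N) (h : m + 1 < m + 2),
      (Fin.snoc (Fin.snoc c x : Fin (m + 1) → Fin N) y : Fin (m + 2) → Fin N) ⟨m + 1, h⟩ = y :=
    fun c x y h => Fin.snoc_last (α := fun _ => Fin N) (n := m + 1) y (Fin.snoc c x)
  have e3 : (∀ j : Fin (m + 2), (j : ℕ) ≠ m → (j : ℕ) ≠ m + 1 →
      (Fin.snoc (Fin.snoc a s : Fin (m + 1) → Fin N) t : Fin (m + 2) → Fin N) j =
      (Fin.snoc (Fin.snoc b u : Fin (m + 1) → Fin N) v : Fin (m + 2) → Fin N) j) ↔ a = b := by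
    simp only [Fin.forall_fin_succ', Fin.snoc_castSucc, Fin.snoc_last, Fin.val_castSucc,
      Fin.val_last, funext_iff]
    constructor
    · exact fun h j => h.1.1 j (by omega) (by omega)
    · exact fun h => ⟨⟨fun j _ _ => h j, fun h => absurd rfl h⟩, fun _ h => absurd rfl h⟩
  simp [site, e1, e2, e3]

lemma site1_zero_cons {m : ℕ} (X : Matrix (Fin N) (Fin N) A) (s t : Fin N)
    (a b : Fin m → Fin N) :
    site1 (m + 1) 0 X (Fin.cons s a) (Fin.cons t b) = X s t * if a = b then 1 else 0 := by
  simp [site1, Fin.forall_fin_succ, funext_iff]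

lemma site1_zero_succ_eq_extRight {m : ℕ} (h : 0 < m) (X : Matrix (Fin N) (Fin N) A) :
    site1 (m + 1) 0 X = extRight (site1 m 0 X) := by
  refine ext_snoc fun a s b t => ?_
  have e : ∀ (h' : 0 < m + 1) (c : Fin m → Fin N) (u : Fin N),
      Fin.snoc (α := fun _ => Fin N) c u ⟨0, h'⟩ = c ⟨0, h⟩ := fun h' c u =>
    Fin.snoc_castSucc (α := fun _ => Fin N) (n := m) u c ⟨0, h⟩
  have e' : (∀ j : Fin (m + 1), (j : ℕ) ≠ 0 → Fin.snoc (α := fun _ => Fin N) a s j =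
      Fin.snoc (α := fun _ => Fin N) b t j) ↔ (∀ j : Fin m, (j : ℕ) ≠ 0 → a j = b j) ∧ s = t := by
    simp only [Fin.forall_fin_succ', Fin.snoc_castSucc, Fin.snoc_last, Fin.val_castSucc,
      Fin.val_last]
    exact and_congr Iff.rfl ⟨fun hs => hs (by omega), fun hs _ => hs⟩
  simp only [extRight_snoc, site1, h, Nat.succ_pos, dif_pos, e, e', mul_assoc]
  congr 1
  by_cases hs : s = t <;> simp [hs]

lemma site_mul (m i : ℕ) (X Y : M2 N A) : site m i X * site m i Y = site m i (X * Y) := by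
  rcases le_or_gt m (i + 1) with h | h
  · simp [site_of_le h]
  induction i generalizing m with
  | zero =>
    obtain ⟨m, rfl⟩ := Nat.exists_eq_add_of_le' h
    refine ext_cons fun s a t b => ?_
    rw [← Fin.cons_self_tail a, ← Fin.cons_self_tail b]
    simp only [Matrix.mul_apply, sum_cons, site_zero_cons, Fintype.sum_prod_type, Finset.sum_mul]
    refine Finset.sum_congr rfl fun _ _ => Finset.sum_congr rfl fun _ _ => ?_
    simp
  | succ i ih =>
    obtain ⟨m, rfl⟩ := Nat.exists_eq_add_of_le' (show 1 ≤ m by omega)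
    simp only [site_succ_eq_extLeft, ← extLeft_mul, ih m (by omega)]

lemma site_one (m i : ℕ) : site m i (1 : M2 N A) = 1 := by
  rcases le_or_gt m (i + 1) with h | h
  · exact site_of_le h _
  induction i generalizing m with
  | zero =>
    obtain ⟨m, rfl⟩ := Nat.exists_eq_add_of_le' h
    refine ext_cons fun s a t b => ?_
    rw [← Fin.cons_self_tail a, ← Fin.cons_self_tail b, site_zero_cons]
    simp only [Matrix.one_apply, Prod.mk.injEq, Fin.cons_inj]
    split_ifs <;> simp_all
  | succ i ih =>
    obtain ⟨m, rfl⟩ := Nat.exists_eq_add_of_le' (show 1 ≤ m by omega)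
    rw [site_succ_eq_extLeft, ih m (by omega), extLeft_one]

end Extension

section Relations

variable {K : Type*} [Field K] {A : Type*} [Ring A] [Algebra K A] {N : ℕ}

lemma site_map (m i : ℕ) (X : M2 N K) :
    (site m i X).map (algebraMap K A) = site m i (X.map (algebraMap K A)) := by
  ext a b
  simp only [site, Matrix.map_apply]
  split_ifs <;> simp

lemma extRight_map {m : ℕ} (X : Op N K m) :
    (extRight X).map (algebraMap K A) = extRight (X.map (algebraMap K A)) := by
  ext a b
  simp only [extRight, Matrix.map_apply]
  split_ifs <;> simp

lemma site1_zero_commute {m i : ℕ} (M : Matrix (Fin N) (Fin N) A) (X : M2 N K) (hi : 1 ≤ i) :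
    Commute (site1 m 0 M) (site m i (X.map (algebraMap K A))) := by
  rcases le_or_gt m (i + 1) with h | h
  · rw [site_of_le h]
    exact Commute.one_right _
  obtain ⟨i, rfl⟩ := Nat.exists_eq_add_of_le' hi
  obtain ⟨m, rfl⟩ := Nat.exists_eq_add_of_le' (show 1 ≤ m by omega)
  rw [site_succ_eq_extLeft, ← site_map]
  refine ext_cons fun s a t b => ?_
  simp [Matrix.mul_apply, sum_cons, site1_zero_cons, Algebra.commutes]

lemma site_zero_commute {m i : ℕ} (X Y : M2 N K) (hi : 2 ≤ i) :
    Commute (site m 0 (X.map (algebraMap K A))) (site m i (Y.map (algebraMap K A))) := by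
  rcases le_or_gt m (i + 1) with h | h
  · rw [site_of_le h]
    exact Commute.one_right _
  obtain ⟨i, rfl⟩ := Nat.exists_eq_add_of_le' hi
  obtain ⟨m, rfl⟩ := Nat.exists_eq_add_of_le' (show 2 ≤ m by omega)
  rw [site_succ_eq_extLeft, site_succ_eq_extLeft, ← site_map]
  refine ext_cons fun s a t b => ?_
  obtain ⟨a₀, a, rfl⟩ : ∃ x y, a = Fin.cons x y := ⟨_, _, (Fin.cons_self_tail a).symm⟩
  obtain ⟨b₀, b, rfl⟩ : ∃ x y, b = Fin.cons x y := ⟨_, _, (Fin.cons_self_tail b).symm⟩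
  simp [Matrix.mul_apply, sum_cons, site_zero_cons, Algebra.commutes,
    apply_ite (algebraMap K A)]

lemma site_commute {m i j : ℕ} (X Y : M2 N K) (hij : i + 1 < j) :
    Commute (site m i (X.map (algebraMap K A))) (site m j (Y.map (algebraMap K A))) := by
  induction i generalizing m j with
  | zero => exact site_zero_commute X Y hij
  | succ i ih =>
    obtain ⟨j, rfl⟩ := Nat.exists_eq_add_of_le' (show 1 ≤ j by omega)
    rcases Nat.eq_zero_or_pos m with rfl | h
    · rw [site_of_le (by omega)]
      exact Commute.one_left _
    obtain ⟨m, rfl⟩ := Nat.exists_eq_add_of_le' h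
    have := ih (m := m) (j := j) (by omega)
    rw [site_succ_eq_extLeft, site_succ_eq_extLeft, Commute, SemiconjBy, ← extLeft_mul,
      this.eq, extLeft_mul]

/-- A braid-type relation between three two-site operators on `V^{⊗3}` holds at every position
of every longer tensor power. -/
lemma site_relation {X Y Z X' Y' Z' : M2 N K} {p₁ p₂ p₃ q₁ q₂ q₃ : ℕ}
    (hp₁ : p₁ < 2) (hp₂ : p₂ < 2) (hp₃ : p₃ < 2) (hq₁ : q₁ < 2) (hq₂ : q₂ < 2) (hq₃ : q₃ < 2)
    (h : site 3 p₁ X * site 3 p₂ Y * site 3 p₃ Z = site 3 q₁ X' * site 3 q₂ Y' * site 3 q₃ Z')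
    {m i : ℕ} (hi : i + 2 < m) :
    site m (p₁ + i) (X.map (algebraMap K A)) * site m (p₂ + i) (Y.map (algebraMap K A)) *
        site m (p₃ + i) (Z.map (algebraMap K A)) =
      site m (q₁ + i) (X'.map (algebraMap K A)) * site m (q₂ + i) (Y'.map (algebraMap K A)) *
        site m (q₃ + i) (Z'.map (algebraMap K A)) := by
  induction i generalizing m with
  | zero =>
    obtain ⟨m, rfl⟩ : ∃ k, m = k + 3 := ⟨m - 3, by omega⟩
    clear hi
    induction m with
    | zero =>
      have := congrArg (fun W => W.map (algebraMap K A)) h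
      simp only [Matrix.map_mul, site_map] at this
      exact this
    | succ m ih =>
      have := congrArg extRight ih
      simp only [extRight_mul] at this
      have e : ∀ p, p < 2 → ∀ W : M2 N A,
          site (m + 1 + 3) (p + 0) W = extRight (site (m + 3) (p + 0) W) :=
        fun p hp W => site_succ_eq_extRight (m := m + 3) (by omega) W
      rw [e _ hp₁, e _ hp₂, e _ hp₃, e _ hq₁, e _ hq₂, e _ hq₃]
      exact this
  | succ i ih =>
    obtain ⟨m, rfl⟩ := Nat.exists_eq_add_of_le' (show 1 ≤ m by omega)
    simp only [← add_assoc, site_succ_eq_extLeft, ← extLeft_mul, ih (show i + 2 < m by omega)]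

lemma site_mul_inv {F : M2 N K} (hF : IsUnit F) (m i : ℕ) :
    site m i (F.map (algebraMap K A)) * site m i ((F⁻¹).map (algebraMap K A)) = 1 := by
  have : F.map (algebraMap K A) * (F⁻¹).map (algebraMap K A) = 1 := by
    rw [← Matrix.map_mul, Matrix.mul_nonsing_inv _ ((Matrix.isUnit_iff_isUnit_det _).1 hF)]
    simp
  rw [site_mul, this, site_one]

lemma site_inv_mul {F : M2 N K} (hF : IsUnit F) (m i : ℕ) :
    site m i ((F⁻¹).map (algebraMap K A)) * site m i (F.map (algebraMap K A)) = 1 := by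
  have : (F⁻¹).map (algebraMap K A) * F.map (algebraMap K A) = 1 := by
    rw [← Matrix.map_mul, Matrix.nonsing_inv_mul _ ((Matrix.isUnit_iff_isUnit_det _).1 hF)]
    simp
  rw [site_mul, this, site_one]

end Relations

section PartialTrace

variable {K : Type*} [Field K] {N : ℕ}

lemma sum_triple {B : Type*} [AddCommMonoid B] (f : (Fin 3 → Fin N) → B) :
    ∑ x, f x = ∑ a : Fin N, ∑ b : Fin N, ∑ c : Fin N, f ![a, b, c] := by
  simp only [sum_cons (m := 2), sum_cons (m := 1), sum_cons (m := 0), Fintype.sum_unique]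
  refine Finset.sum_congr rfl fun a _ => Finset.sum_congr rfl fun b _ =>
    Finset.sum_congr rfl fun c _ => congrArg f ?_
  rw [Subsingleton.elim default ![]]
  rfl

lemma site_three_zero {A : Type*} [Ring A] (X : M2 N A) (a b c a' b' c' : Fin N) :
    site 3 0 X ![a, b, c] ![a', b', c'] = X (a, b) (a', b') * if c = c' then 1 else 0 := by
  simp [site, Fin.forall_fin_succ]

lemma site_three_one {A : Type*} [Ring A] (X : M2 N A) (a b c a' b' c' : Fin N) :
    site 3 1 X ![a, b, c] ![a', b', c'] = X (b, c) (b', c') * if a = a' then 1 else 0 := by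
  simp [site, Fin.forall_fin_succ]

/-- The relation `∑ F̂^{gb}_{fd} Ψ^{df'}_{bg'} = δ^g_{g'} δ^{f'}_f`: the defining relation of `Ψ`
with the two factors interchanged. -/
lemma IsClosedPair.swap {F Ψ : M2 N K} (hΨ : IsClosedPair F Ψ) (g f g' f' : Fin N) :
    (∑ b : Fin N, ∑ d : Fin N, F (g, b) (f, d) * Ψ (d, f') (b, g')) =
      if g = g' ∧ f = f' then 1 else 0 := by
  let P : M2 N K := fun x y => Ψ (x.1, y.2) (x.2, y.1)
  let Q : M2 N K := fun x y => F (x.1, y.2) (x.2, y.1)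
  have hPQ : P * Q = 1 := by
    ext ⟨a, c⟩ ⟨d, b⟩
    have := hΨ a b c d
    rw [Finset.sum_comm] at this
    rw [Matrix.mul_apply, Fintype.sum_prod_type, Matrix.one_apply]
    simp only [P, Q, this, Prod.mk.injEq, @eq_comm _ b c]
  have hQP : Q * P = 1 := mul_eq_one_comm.1 hPQ
  replace hQP := congrFun (congrFun hQP (g, f)) (g', f')
  rw [Matrix.mul_apply, Fintype.sum_prod_type, Finset.sum_comm, Matrix.one_apply] at hQP
  simpa only [P, Q, Prod.mk.injEq] using hQP

lemma IsClosedPair.sum_Dmat_mul {F Ψ : M2 N K} (hΨ : IsClosedPair F Ψ) (t u : Fin N) :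
    (∑ b : Fin N, ∑ a : Fin N, Dmat Ψ b a * F (t, a) (u, b)) = if t = u then 1 else 0 := by
  have : ∀ c : Fin N, _ := fun c => hΨ.swap t u c c
  calc _ = ∑ c : Fin N, ∑ a : Fin N, ∑ b : Fin N, F (t, a) (u, b) * Ψ (b, c) (a, c) := by
        simp only [Dmat, Finset.sum_mul]
        rw [← Finset.sum_comm_cycle, Finset.sum_comm]
        simp only [mul_comm]
    _ = _ := by
        simp only [this]
        by_cases h : t = u
        · simp [h]
        · rw [if_neg h]
          exact Finset.sum_eq_zero fun c _ => if_neg fun hc => h (hc.1.trans hc.2.symm)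

/-- The braid relation in the form `F̂₂F̂₁F̂₂⁻¹ = F̂₁⁻¹F̂₂F̂₁`, in components. -/
lemma YB.conj_apply {F : M2 N K} (hF : IsUnit F) (h : YB F) (a₁ a₂ a₃ b₁ b₂ b₃ : Fin N) :
    (∑ u, ∑ t, ∑ s, F (a₂, a₃) (s, t) * F (a₁, s) (b₁, u) * F⁻¹ (u, t) (b₂, b₃)) =
      ∑ s, ∑ u, ∑ t, F⁻¹ (a₁, a₂) (s, t) * F (t, a₃) (u, b₃) * F (s, u) (b₁, b₂) := by
  have h0 : site 3 0 F⁻¹ * site 3 0 F = 1 := by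
    simpa using site_inv_mul (A := K) hF 3 0
  have h1 : site 3 1 F * site 3 1 F⁻¹ = 1 := by
    simpa using site_mul_inv (A := K) hF 3 1
  have key : site 3 1 F * site 3 0 F * site 3 1 F⁻¹ =
      site 3 0 F⁻¹ * site 3 1 F * site 3 0 F := by
    calc _ = site 3 0 F⁻¹ * (site 3 0 F * site 3 1 F * site 3 0 F) * site 3 1 F⁻¹ := by
          simp only [← mul_assoc, h0, one_mul]
      _ = _ := by
          rw [show site 3 0 F * site 3 1 F * site 3 0 F = _ from h]
          simp only [mul_assoc, h1, mul_one]
  have := congrFun (congrFun key ![a₁, a₂, a₃]) ![b₁, b₂, b₃]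
  simp only [Matrix.mul_apply, sum_triple, site_three_zero, site_three_one, Finset.sum_mul] at this
  simpa using this

lemma sum_comm_two_three {ι B : Type*} [Fintype ι] [AddCommMonoid B]
    (f : ι → ι → ι → ι → ι → B) :
    ∑ a, ∑ b, ∑ c, ∑ d, ∑ e, f a b c d e = ∑ c, ∑ d, ∑ e, ∑ a, ∑ b, f a b c d e := by
  rw [← Fintype.sum_prod_type' (f := fun a b => ∑ c, ∑ d, ∑ e, f a b c d e), Finset.sum_comm]
  refine Finset.sum_congr rfl fun c _ => ?_
  rw [Finset.sum_comm]
  refine Finset.sum_congr rfl fun d _ => ?_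
  rw [Finset.sum_comm]
  exact Finset.sum_congr rfl fun e _ => Fintype.sum_prod_type' fun a b => f a b c d e

/-- The partial trace relation `Tr_F(2)(F̂ P₀₁ F̂⁻¹) = D₀`, in components. -/
lemma sum_Dmat_conj {F Ψ : M2 N K} (hF : IsUnit F) (hΨ : IsClosedPair F Ψ) (h : YB F)
    (a b x z : Fin N) :
    (∑ c, ∑ e, Dmat Ψ c e * ∑ t, F (a, e) (x, t) * F⁻¹ (z, t) (b, c)) =
      if a = b then Dmat Ψ z x else 0 := by
  have hinv : F⁻¹ * F = 1 := Matrix.nonsing_inv_mul _ ((Matrix.isUnit_iff_isUnit_det _).1 hF)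
  have left : ∀ e c, ∑ f, ∑ g, Ψ (z, f) (x, g) *
      (∑ u, ∑ t, ∑ s, F (a, e) (s, t) * F (g, s) (f, u) * F⁻¹ (u, t) (b, c)) =
        ∑ t, F (a, e) (x, t) * F⁻¹ (z, t) (b, c) := by
    intro e c
    simp only [Finset.mul_sum]
    rw [sum_comm_two_three]
    calc _ = ∑ u, ∑ t, ∑ s, F (a, e) (s, t) * F⁻¹ (u, t) (b, c) *
          ∑ f, ∑ g, Ψ (z, f) (x, g) * F (g, s) (f, u) := by
          simp only [Finset.mul_sum]
          refine Finset.sum_congr rfl fun u _ => Finset.sum_congr rfl fun t _ =>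
            Finset.sum_congr rfl fun s _ => Finset.sum_congr rfl fun f _ =>
            Finset.sum_congr rfl fun g _ => by ring
      _ = _ := by
          simp only [hΨ z _ x _, ite_and]
          simp
  have right : ∀ f g, ∑ c, ∑ e, Dmat Ψ c e *
      (∑ s, ∑ u, ∑ t, F⁻¹ (g, a) (s, t) * F (t, e) (u, c) * F (s, u) (f, b)) =
        if g = f ∧ a = b then 1 else 0 := by
    intro f g
    simp only [Finset.mul_sum]
    rw [sum_comm_two_three]
    calc _ = ∑ s, ∑ u, ∑ t, F⁻¹ (g, a) (s, t) * F (s, u) (f, b) *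
          ∑ c, ∑ e, Dmat Ψ c e * F (t, e) (u, c) := by
          simp only [Finset.mul_sum]
          refine Finset.sum_congr rfl fun s _ => Finset.sum_congr rfl fun u _ =>
            Finset.sum_congr rfl fun t _ => Finset.sum_congr rfl fun c _ =>
            Finset.sum_congr rfl fun e _ => by ring
      _ = (F⁻¹ * F) (g, a) (f, b) := by
          simp [hΨ.sum_Dmat_mul, Matrix.mul_apply, Fintype.sum_prod_type]
      _ = _ := by simp [hinv, Matrix.one_apply]
  calc _ = ∑ c, ∑ e, ∑ f, ∑ g, Dmat Ψ c e * (Ψ (z, f) (x, g) *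
      (∑ s, ∑ u, ∑ t, F⁻¹ (g, a) (s, t) * F (t, e) (u, c) * F (s, u) (f, b))) := by
        simp only [← left, h.conj_apply hF, Finset.mul_sum]
    _ = ∑ f, ∑ g, Ψ (z, f) (x, g) * ∑ c, ∑ e, Dmat Ψ c e *
      (∑ s, ∑ u, ∑ t, F⁻¹ (g, a) (s, t) * F (t, e) (u, c) * F (s, u) (f, b)) := by
        rw [← Fintype.sum_prod_type' (f := fun c e => ∑ f, ∑ g, Dmat Ψ c e * (Ψ (z, f) (x, g) *
          (∑ s, ∑ u, ∑ t, F⁻¹ (g, a) (s, t) * F (t, e) (u, c) * F (s, u) (f, b)))),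
          Finset.sum_comm]
        refine Finset.sum_congr rfl fun f _ => ?_
        rw [Finset.sum_comm]
        refine Finset.sum_congr rfl fun g _ => ?_
        rw [Fintype.sum_prod_type]
        simp only [Finset.mul_sum, mul_left_comm]
    _ = _ := by
        simp only [right]
        by_cases hab : a = b <;> simp [hab, Dmat]

end PartialTrace

section QuantumTrace

variable {K : Type*} [Field K] {A : Type*} [Ring A] [Algebra K A] {N : ℕ}

lemma qtr1_extRight_mul {m : ℕ} (D : Matrix (Fin N) (Fin N) K) (X : Op N A m)
    (Y : Op N A (m + 1)) : qtr1 D (extRight X * Y) = X * qtr1 D Y := by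
  ext a b
  simp only [qtr1, Matrix.mul_apply, sum_snoc, extRight_snoc, Finset.mul_sum]
  rw [Finset.sum_comm_cycle]
  simp [Algebra.left_comm]

lemma qtr1_mul_extRight {m : ℕ} (D : Matrix (Fin N) (Fin N) K) (X : Op N A m)
    (Y : Op N A (m + 1)) : qtr1 D (Y * extRight X) = qtr1 D Y * X := by
  ext a b
  simp only [qtr1, Matrix.mul_apply, sum_snoc, extRight_snoc, Finset.mul_sum, Finset.sum_mul]
  rw [Finset.sum_comm_cycle]
  simp [mul_assoc]

/-- The quantum trace of a conjugation by `F̂`: `Tr_F(m+2)(F̂ (X ⊗ 1) F̂⁻¹) = Tr_F(m+1)(X) ⊗ 1`. -/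
lemma qtr1_conj {F Ψ : M2 N K} (hF : IsUnit F) (hΨ : IsClosedPair F Ψ) (h : YB F) {m : ℕ}
    (X : Op N A (m + 1)) :
    qtr1 (Dmat Ψ) (site (m + 2) m (F.map (algebraMap K A)) * extRight X *
      site (m + 2) m ((F⁻¹).map (algebraMap K A))) = extRight (qtr1 (Dmat Ψ) X) := by
  refine ext_snoc fun a s b t => ?_
  have comm : ∀ (k : K) i j, X i j * algebraMap K A k = algebraMap K A k * X i j :=
    fun k i j => (Algebra.commutes k _).symm
  calc _ = ∑ c, ∑ e, ∑ u, ∑ v, ∑ x,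
        algebraMap K A (Dmat Ψ c e * (F (s, e) (x, v) * F⁻¹ (u, v) (t, c))) *
          X (Fin.snoc a x) (Fin.snoc b u) := by
        simp [qtr1, Matrix.mul_apply, sum_snoc, site_last_snoc, Finset.mul_sum, Finset.sum_mul,
          mul_assoc, comm]
    _ = ∑ u, ∑ x, algebraMap K A (∑ c, ∑ e, Dmat Ψ c e *
          ∑ v, F (s, e) (x, v) * F⁻¹ (u, v) (t, c)) *
            X (Fin.snoc a x) (Fin.snoc b u) := by
        rw [sum_comm_two_three]
        refine Finset.sum_congr rfl fun u _ => ?_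
        rw [Finset.sum_comm]
        refine Finset.sum_congr rfl fun x _ => ?_
        rw [map_sum]
        simp only [map_sum, Finset.mul_sum, Finset.sum_mul]
        exact Finset.sum_comm_cycle.symm
    _ = _ := by
        simp only [sum_Dmat_conj hF hΨ h]
        by_cases hst : s = t <;> simp [hst, qtr1]

lemma qtrAll_qtr1 {m : ℕ} (D : Matrix (Fin N) (Fin N) K) (X : Op N A (m + 1)) :
    qtrAll D (qtr1 D X) = qtrAll D X := by
  simp only [qtrAll, qtr1, sum_snoc, Fin.prod_univ_castSucc, Fin.snoc_castSucc, Fin.snoc_last,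
    Finset.mul_sum, map_mul, mul_assoc]
  exact Finset.sum_congr rfl fun x _ => Finset.sum_comm

lemma eq_qtrAll_smul_one (D : Matrix (Fin N) (Fin N) K) (X : Op N A 0) :
    X = qtrAll D X • 1 := by
  ext a b
  simp [qtrAll, Subsingleton.elim a default, Subsingleton.elim b default]

/-- Quantum trace of an operator on `V^{⊗n}` over the last `j` factors, where `n = m + j`. -/
def qtrLast (D : Matrix (Fin N) (Fin N) K) {m n j : ℕ} (h : n = m + j) (X : Op N A n) :
    Op N A m :=
  qtrs D m j (h ▸ X)

lemma qtrLast_rfl (D : Matrix (Fin N) (Fin N) K) {m j : ℕ} (X : Op N A (m + j)) :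
    qtrLast D rfl X = qtrs D m j X := rfl

lemma qtrLast_succ (D : Matrix (Fin N) (Fin N) K) {m n j : ℕ} (h : n + 1 = m + (j + 1))
    (h' : n = m + j) (X : Op N A (n + 1)) : qtrLast D h X = qtrLast D h' (qtr1 D X) := by
  subst h'
  rfl

lemma qtrLast_qtrLast (D : Matrix (Fin N) (Fin N) K) {m k n d j l : ℕ} (h : k = m + d)
    (h' : n = k + j) (h'' : n = m + l) (hl : l = d + j) (X : Op N A n) :
    qtrLast D h (qtrLast D h' X) = qtrLast D h'' X := by
  subst hl
  induction j generalizing n with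
  | zero =>
    obtain rfl : n = k := h'
    rfl
  | succ j ih =>
    obtain ⟨n, rfl⟩ : ∃ r, n = r + 1 := ⟨k + j, h'⟩
    have h₁ : n = k + j := by omega
    have h₂ : n = m + (d + j) := by omega
    rw [qtrLast_succ D h' h₁, ih h₁ _ h₂]
    exact (qtrLast_succ D h'' h₂ X).symm

lemma qtrAll_qtrLast (D : Matrix (Fin N) (Fin N) K) {m n j : ℕ} (h : n = m + j)
    (X : Op N A n) : qtrAll D (qtrLast D h X) = qtrAll D X := by
  induction j generalizing n with
  | zero =>
    obtain rfl : n = m := h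
    rfl
  | succ j ih =>
    obtain ⟨n, rfl⟩ : ∃ r, n = r + 1 := ⟨m + j, h⟩
    rw [qtrLast_succ D h (by omega), ih, qtrAll_qtr1]

/-- Operators acting on the first `m` factors can be pulled out of a quantum trace over the
remaining ones. -/
lemma qtrLast_mul_left (D : Matrix (Fin N) (Fin N) K) {m n j : ℕ} (h : n = m + j)
    (Z : ∀ r, Op N A r) (hZ : ∀ r, m ≤ r → Z (r + 1) = extRight (Z r)) (X : Op N A n) :
    qtrLast D h (Z n * X) = Z m * qtrLast D h X := by
  induction j generalizing n with
  | zero =>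
    obtain rfl : n = m := h
    rfl
  | succ j ih =>
    obtain ⟨n, rfl⟩ : ∃ r, n = r + 1 := ⟨m + j, h⟩
    rw [qtrLast_succ D h (by omega), qtrLast_succ D h (by omega), hZ n (by omega),
      qtr1_extRight_mul, ih]

lemma qtrLast_mul_smul_one (D : Matrix (Fin N) (Fin N) K) {m n j : ℕ} (h : n = m + j)
    (x : A) (X : Op N A n) :
    qtrLast D h (X * x • (1 : Op N A n)) = qtrLast D h X * x • (1 : Op N A m) := by
  induction j generalizing n with
  | zero =>
    obtain rfl : n = m := h
    rfl
  | succ j ih =>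
    obtain ⟨n, rfl⟩ : ∃ r, n = r + 1 := ⟨m + j, h⟩
    rw [qtrLast_succ D h (by omega), qtrLast_succ D h (by omega), ← extRight_smul_one,
      qtr1_mul_extRight, ih]

end QuantumTrace

section Stability

variable {A : Type*} [Ring A] {N : ℕ}

lemma extRight_sub {m : ℕ} (X Y : Op N A m) : extRight (X - Y) = extRight X - extRight Y := by
  ext a b
  simp only [extRight, Matrix.sub_apply, sub_mul]

lemma extRight_smul {m : ℕ} (c : A) (X : Op N A m) : extRight (c • X) = c • extRight X := by
  ext a b
  simp [extRight]

lemma chain_succ_eq_extRight {n p i : ℕ} (h : p + i < n) (X : M2 N A) :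
    chain (n + 1) X p i = extRight (chain n X p i) := by
  induction i with
  | zero => exact extRight_one.symm
  | succ i ih =>
    rw [chain, chain, extRight_mul, ih (by omega), site_succ_eq_extRight (by omega)]

lemma Mbar_succ_eq_extRight {n k : ℕ} (h : k < n) (F G : M2 N A)
    (M : Matrix (Fin N) (Fin N) A) :
    Mbar (n + 1) F G M k = extRight (Mbar n F G M k) := by
  induction k with
  | zero => exact site1_zero_succ_eq_extRight h M
  | succ k ih =>
    rw [Mbar, Mbar, extRight_mul, extRight_mul, ih (by omega), site_succ_eq_extRight h,
      site_succ_eq_extRight h]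

lemma MbarSeg_succ_eq_extRight {n p i : ℕ} (h : p + i ≤ n) (F G : M2 N A)
    (M : Matrix (Fin N) (Fin N) A) :
    MbarSeg (n + 1) F G M p i = extRight (MbarSeg n F G M p i) := by
  induction i with
  | zero => exact extRight_one.symm
  | succ i ih =>
    rw [MbarSeg, MbarSeg, extRight_mul, ih (by omega), Mbar_succ_eq_extRight (by omega)]

lemma MbarSeg_add (n : ℕ) (F G : M2 N A) (M : Matrix (Fin N) (Fin N) A) (p i j : ℕ) :
    MbarSeg n F G M p (i + j) = MbarSeg n F G M p i * MbarSeg n F G M (p + i) j := by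
  induction j with
  | zero => exact (mul_one _).symm
  | succ j ih => rw [← add_assoc, MbarSeg, MbarSeg, ih, mul_assoc, add_assoc p i j]

lemma qasym_succ_eq_extRight {K : Type*} [Field K] (q : K) (R : M2 N K) {n p i : ℕ}
    (h : p + i ≤ n) : qasym q R (n + 1) p i = extRight (qasym q R n p i) := by
  induction i with
  | zero => exact extRight_one.symm
  | succ i ih =>
    cases i with
    | zero => exact extRight_one.symm
    | succ i =>
      rw [qasym, qasym, ih (by omega), site_succ_eq_extRight (by omega)]
      simp only [extRight_smul, extRight_sub, extRight_mul, extRight_one]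

/-- The product of the operators `X_{i+l-1} ⋯ X_{i+1} X_i`, in the order opposite to `chain`. -/
def chainRev (m : ℕ) (X : M2 N A) (i : ℕ) : ℕ → Op N A m
  | 0 => 1
  | l + 1 => site m (i + l) X * chainRev m X i l

lemma chainRev_succ_eq_extRight {n p i : ℕ} (h : p + i < n) (X : M2 N A) :
    chainRev (n + 1) X p i = extRight (chainRev n X p i) := by
  induction i with
  | zero => exact extRight_one.symm
  | succ i ih =>
    rw [chainRev, chainRev, extRight_mul, ih (by omega), site_succ_eq_extRight (by omega)]

lemma chain_commute {n p i : ℕ} {X : M2 N A} {Y : Op N A n}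
    (h : ∀ l, p ≤ l → l < p + i → Commute (site n l X) Y) : Commute (chain n X p i) Y := by
  induction i with
  | zero => exact Commute.one_left _
  | succ i ih =>
    exact (ih fun l h₁ h₂ => h l h₁ (by omega)).mul_left (h _ (by omega) (by omega))

end Stability

section Shift

variable {K : Type*} [Field K] {A : Type*} [Ring A] [Algebra K A] {N : ℕ}

lemma chain_mul_chainRev {F : M2 N K} (hF : IsUnit F) (n p i : ℕ) :
    chain n (F.map (algebraMap K A)) p i * chainRev n ((F⁻¹).map (algebraMap K A)) p i = 1 := by
  induction i with
  | zero => exact mul_one _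
  | succ i ih =>
    rw [chain, chainRev, mul_assoc, ← mul_assoc (site _ _ _), site_mul_inv hF, one_mul, ih]

lemma Mbar_commute_site (F X : M2 N K) (M : Matrix (Fin N) (Fin N) A) {n k l : ℕ}
    (h : k < l) :
    Commute (Mbar n (F.map (algebraMap K A)) ((F⁻¹).map (algebraMap K A)) M k)
      (site n l (X.map (algebraMap K A))) := by
  induction k with
  | zero => exact site1_zero_commute M X h
  | succ k ih =>
    exact ((site_commute F X h).mul_left (ih (by omega))).mul_left (site_commute F⁻¹ X h)

lemma MbarSeg_commute_site (F X : M2 N K) (M : Matrix (Fin N) (Fin N) A) {n p i l : ℕ}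
    (h : p + i ≤ l) :
    Commute (MbarSeg n (F.map (algebraMap K A)) ((F⁻¹).map (algebraMap K A)) M p i)
      (site n l (X.map (algebraMap K A))) := by
  induction i with
  | zero => exact Commute.one_left _
  | succ i ih => exact (ih (by omega)).mul_left (Mbar_commute_site F X M (by omega))

lemma site_commute_Mbar {F : M2 N K} (hF : IsUnit F) (h : YB F)
    (M : Matrix (Fin N) (Fin N) A) {n k l : ℕ} (hl : l < k) (hk : k + 1 < n) :
    Commute (site n l (F.map (algebraMap K A)))
      (Mbar n (F.map (algebraMap K A)) ((F⁻¹).map (algebraMap K A)) M (k + 1)) := by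
  induction k with
  | zero => omega
  | succ k ih =>
    rcases Nat.lt_succ_iff_lt_or_eq.1 hl with hlk | rfl
    · exact ((site_commute F F (by omega)).mul_right (ih hlk (by omega))).mul_right
        (site_commute F F⁻¹ (by omega))
    · have yb := site_relation (A := A) (by omega) (by omega) (by omega) (by omega) (by omega)
        (by omega) h (m := n) (i := l) (by omega)
      rw [zero_add, add_comm 1 l] at yb
      have hc := Mbar_commute_site (n := n) F F M (Nat.lt_succ_self l)
      have a₁ := site_inv_mul (A := A) hF n l
      have b₁ := site_mul_inv (A := A) hF n l
      have a₂ := site_inv_mul (A := A) hF n (l + 1)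
      have b₂ := site_mul_inv (A := A) hF n (l + 1)
      rw [Commute, SemiconjBy, Mbar, Mbar]
      generalize Mbar n (F.map (algebraMap K A)) ((F⁻¹).map (algebraMap K A)) M l = m at *
      generalize site n l (F.map (algebraMap K A)) = f at *
      generalize site n (l + 1) (F.map (algebraMap K A)) = f' at *
      generalize site n l ((F⁻¹).map (algebraMap K A)) = g at *
      generalize site n (l + 1) ((F⁻¹).map (algebraMap K A)) = g' at *
      have key : f' * g * g' = g * g' * f := by
        calc f' * g * g' = g * (g' * f') * f * f' * g * g' := by simp [a₁, a₂]
          _ = g * g' * (f' * f * f') * g * g' := by simp only [mul_assoc]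
          _ = g * g' * f * f' * (f * g) * g' := by rw [← yb]; simp only [mul_assoc]
          _ = g * g' * f := by simp [mul_assoc, b₁, b₂]
      calc f * (f' * (f * m * g) * g') = (f * f' * f) * m * g * g' := by simp only [mul_assoc]
        _ = f' * f * (m * f') * g * g' := by rw [yb, hc.eq]; simp only [mul_assoc]
        _ = f' * f * m * (f' * g * g') := by simp only [mul_assoc]
        _ = _ := by rw [key]; simp only [mul_assoc]

lemma chain_semiconjBy_Mbar {F : M2 N K} (hF : IsUnit F) (h : YB F)
    (M : Matrix (Fin N) (Fin N) A) {n p i k : ℕ} (hp : p ≤ k) (hk : k < p + i)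
    (hn : p + i < n) :
    SemiconjBy (chain n (F.map (algebraMap K A)) p i)
      (Mbar n (F.map (algebraMap K A)) ((F⁻¹).map (algebraMap K A)) M k)
      (Mbar n (F.map (algebraMap K A)) ((F⁻¹).map (algebraMap K A)) M (k + 1)) := by
  induction i with
  | zero => omega
  | succ i ih =>
    rcases (show k < p + i ∨ k = p + i by omega) with hlk | rfl
    · exact (ih hlk (by omega)).mul_left (Mbar_commute_site F F M hlk).symm
    · refine SemiconjBy.mul_left
        (chain_commute fun l _ h₂ => site_commute_Mbar hF h M h₂ (by omega)) ?_
      rw [SemiconjBy, Mbar, mul_assoc _ _ (site _ _ (F.map _)), site_inv_mul hF, mul_one]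

lemma chain_semiconjBy_MbarSeg {F : M2 N K} (hF : IsUnit F) (h : YB F)
    (M : Matrix (Fin N) (Fin N) A) {n p i j : ℕ} (hj : j ≤ i) (hn : p + i < n) :
    SemiconjBy (chain n (F.map (algebraMap K A)) p i)
      (MbarSeg n (F.map (algebraMap K A)) ((F⁻¹).map (algebraMap K A)) M p j)
      (MbarSeg n (F.map (algebraMap K A)) ((F⁻¹).map (algebraMap K A)) M (p + 1) j) := by
  induction j with
  | zero => exact SemiconjBy.one_right _
  | succ j ih =>
    rw [MbarSeg, MbarSeg, add_right_comm]
    exact (ih (by omega)).mul_right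
      (chain_semiconjBy_Mbar hF h M (Nat.le_add_right p j) (by omega) hn)

lemma chain_semiconjBy_site {R F : M2 N K} (h : Compatible R F) {n p i l : ℕ} (hp : p ≤ l)
    (hl : l + 1 < p + i) (hn : p + i < n) :
    SemiconjBy (chain n (F.map (algebraMap K A)) p i) (site n l (R.map (algebraMap K A)))
      (site n (l + 1) (R.map (algebraMap K A))) := by
  induction i with
  | zero => omega
  | succ i ih =>
    rcases (show l + 1 < p + i ∨ l + 1 = p + i by omega) with hlk | hlk
    · exact (ih hlk (by omega)).mul_left (site_commute R F hlk).symm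
    · obtain ⟨i, rfl⟩ : ∃ r, i = r + 1 := ⟨i - 1, by omega⟩
      obtain rfl : l = p + i := by omega
      have rel := site_relation (A := A) (by omega) (by omega) (by omega) (by omega) (by omega)
        (by omega) h.2.2.2 (m := n) (i := p + i) (by omega)
      rw [zero_add, add_comm 1 (p + i)] at rel
      rw [chain, chain, mul_assoc, ← add_assoc]
      refine SemiconjBy.mul_left
        (chain_commute fun l _ h₂ => site_commute F R (by omega)) ?_
      rw [SemiconjBy, rel, mul_assoc]

/-- An operator intertwining the `R̂_l` with the `R̂_{l+s}` intertwines the corresponding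
`q`-antisymmetrizers. -/
lemma semiconjBy_qasym (q : K) (R : M2 N K) {n p s i : ℕ} {U : Op N A n}
    (h : ∀ l, p ≤ l → l + 1 < p + i → SemiconjBy U (site n l (R.map (algebraMap K A)))
      (site n (l + s) (R.map (algebraMap K A)))) :
    SemiconjBy U ((qasym q R n p i).map (algebraMap K A))
      ((qasym q R n (p + s) i).map (algebraMap K A)) := by
  have one : (1 : Op N K n).map (algebraMap K A) = 1 := Matrix.map_one _ (map_zero _) (map_one _)
  induction i with
  | zero => simp only [qasym, one]; exact SemiconjBy.one_right _
  | succ i ih =>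
    cases i with
    | zero => simp only [qasym, one]; exact SemiconjBy.one_right _
    | succ i =>
      have hi := ih fun l h₁ h₂ => h l h₁ (by omega)
      have hs := h (p + i) (by omega) (by omega)
      rw [add_right_comm] at hs
      have smul : ∀ (c : K) (X : Op N K n),
          (c • X).map (algebraMap K A) = c • X.map (algebraMap K A) := fun c X => by
        ext a b
        exact (map_mul (algebraMap K A) c (X a b)).trans (Algebra.smul_def c _).symm
      have sub : ∀ X Y : Op N K n, (X - Y).map (algebraMap K A) =
          X.map (algebraMap K A) - Y.map (algebraMap K A) := fun X Y => by
        ext; simp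
      have semi : ∀ (c : K) {X Y : Op N A n}, SemiconjBy U X Y → SemiconjBy U (c • X) (c • Y) :=
        fun c X Y hXY => by
          rw [SemiconjBy, mul_smul_comm, hXY.eq, smul_mul_assoc]
      simp only [qasym, smul, Matrix.map_mul, sub, site_map, one]
      exact semi _ ((hi.mul_right ((semi _ (SemiconjBy.one_right U)).sub_right (semi _ hs))).mul_right
        hi)

/-- Conjugation by `F̂_{p+1→p+i}` moves the quantum trace one step to the left. -/
lemma qtrLast_chain_conj {F Ψ : M2 N K} (hF : IsUnit F) (hΨ : IsClosedPair F Ψ) (h : YB F)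
    {p k i : ℕ} (hk : k = p + i) (hk' : k + 1 = p + 1 + i) (X : Op N A k) :
    qtrLast (Dmat Ψ) hk' (chain (k + 1) (F.map (algebraMap K A)) p i * extRight X *
      chainRev (k + 1) ((F⁻¹).map (algebraMap K A)) p i) =
        extRight (qtrLast (Dmat Ψ) hk X) := by
  induction i generalizing k with
  | zero =>
    obtain rfl : k = p := hk
    simp only [chain, chainRev, one_mul, mul_one]
    rfl
  | succ i ih =>
    obtain ⟨k, rfl⟩ : ∃ r, k = r + 1 := ⟨p + i, hk⟩
    have h₁ : k = p + i := by omega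
    rw [qtrLast_succ _ hk h₁, qtrLast_succ _ hk' (by omega), ← ih h₁ (by omega), ← qtr1_conj hF hΨ h,
      chain, chainRev, ← h₁, chain_succ_eq_extRight (by omega), chainRev_succ_eq_extRight (by omega),
      ← qtr1_extRight_mul, ← qtr1_mul_extRight]
    simp only [mul_assoc]

/-- The quantum trace of `A^{(p+1,i)} M_{\overline{p+1}} ⋯ M_{\overline{p+i}}` over the factors
`p+1,…,p+i` is the scalar operator `σ_i(M)`. -/
lemma qtrLast_qasym_mul_MbarSeg (q : K) {R F Ψ : M2 N K} (hF : IsUnit F)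
    (hΨ : IsClosedPair F Ψ) (h : Compatible R F) (M : Matrix (Fin N) (Fin N) A) {p n i : ℕ}
    (hn : n = p + i) :
    qtrLast (Dmat Ψ) hn ((qasym q R n p i).map (algebraMap K A) *
      MbarSeg n (F.map (algebraMap K A)) ((F⁻¹).map (algebraMap K A)) M p i) =
        sigmaF q R F Ψ M i • 1 := by
  induction p generalizing n with
  | zero =>
    obtain rfl : n = i := by omega
    rw [eq_qtrAll_smul_one (Dmat Ψ) (qtrLast _ _ _), qtrAll_qtrLast]
    rfl
  | succ p ih =>
    obtain ⟨k, rfl⟩ : ∃ r, n = r + 1 := ⟨p + i, by omega⟩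
    have hk : k = p + i := by omega
    have hA : SemiconjBy (chain (k + 1) (F.map (algebraMap K A)) p i) _ _ :=
      semiconjBy_qasym (s := 1) (p := p) (i := i) q R
        fun l h₁ h₂ => chain_semiconjBy_site (A := A) h h₁ h₂ (show p + i < k + 1 by omega)
    have hAM := hA.mul_right
      (chain_semiconjBy_MbarSeg hF h.2.1 M le_rfl (show p + i < k + 1 by omega))
    rw [← extRight_smul_one, ← ih hk, ← qtrLast_chain_conj hF hΨ h.2.1 hk, extRight_mul,
      ← extRight_map, ← qasym_succ_eq_extRight q R hk.ge, ← MbarSeg_succ_eq_extRight hk.ge, hAM.eq,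
      mul_assoc _ (chain _ _ _ _), chain_mul_chainRev hF, mul_one]

end Shift

/-- For a Hecke R-matrix `R̂`, a compatible closed R-matrix `F̂`
and a matrix of generators `M` of `M(R̂,F̂)`:  for every `k = j+1 ≥ 1` and
`0 ≤ i ≤ k−1 = j`,
`M^{\overline{k−i}} σ_i(M) = Tr_F(2,…,k)(R̂_{1→k−i−1} A^{(k−i+1,i)} M_{\overline{1}} ⋯ M_{\overline{k}})`,
where `A^{(k−i+1,i)}` is the copy of the `q`-antisymmetrizer `A^{(i)}` acting in
the tensor factors `k−i+1,…,k` (0-based starting position `j−i+1`). -/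
theorem Mpow_sigma_as_trace {K : Type} [Field K] {A : Type} [Ring A] [Algebra K A]
    {N : ℕ} (q : K) (R F Ψ : M2 N K) (M : Matrix (Fin N) (Fin N) A)
    (hq0 : q ≠ 0) (hq1 : q ^ 2 ≠ 1) (hqn : ∀ n : ℕ, 1 ≤ n → qInt q n ≠ 0)
    (hH : IsHecke q R) (hF : IsUnit F) (hΨ : IsClosedPair F Ψ)
    (h : Compatible R F) (hM : IsGenerators R F M) :
    ∀ j i : ℕ, i ≤ j →
      MpowF R F Ψ M (j - i) * (sigmaF q R F Ψ M i • (1 : Op N A 1)) =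
        qtrs (Dmat Ψ) 1 j
          (chain (1 + j) (R.map (algebraMap K A)) 0 (j - i) *
            (qasym q R (1 + j) (j - i + 1) i).map (algebraMap K A) *
            MbarSeg (1 + j) (F.map (algebraMap K A))
              ((F⁻¹).map (algebraMap K A)) M 0 (j + 1)) := by
  intro j i hij
  obtain ⟨d, rfl⟩ := Nat.exists_eq_add_of_le' hij
  rw [Nat.add_sub_cancel]
  have h₁ : 1 + (d + i) = 1 + d + i := (add_assoc 1 d i).symm
  have hcomm := semiconjBy_qasym (s := 0) (p := d + 1) (i := i) q R fun l h₁ _ =>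
    MbarSeg_commute_site (n := 1 + (d + i)) F R M (show 0 + (d + 1) ≤ l by omega)
  have hσ : ∀ (p : ℕ) (hp : 1 + (d + i) = p + i), p = d + 1 → qtrLast (Dmat Ψ) hp
      ((qasym q R (1 + (d + i)) (d + 1) i).map (algebraMap K A) *
        MbarSeg (1 + (d + i)) (F.map (algebraMap K A)) ((F⁻¹).map (algebraMap K A)) M (d + 1) i) =
          sigmaF q R F Ψ M i • 1 := by
    rintro _ hp rfl
    exact qtrLast_qasym_mul_MbarSeg q hF hΨ h M hp
  rw [add_right_comm d i 1, MbarSeg_add, mul_assoc, ← mul_assoc ((qasym q R _ _ _).map _),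
    ← hcomm.eq, mul_assoc (MbarSeg _ _ _ _ _ _), ← mul_assoc (chain _ _ _ _),
    ← qtrLast_rfl, ← qtrLast_qtrLast (Dmat Ψ) rfl h₁ rfl rfl,
    qtrLast_mul_left (Dmat Ψ) h₁ (fun r => chain r (R.map (algebraMap K A)) 0 d *
      MbarSeg r (F.map (algebraMap K A)) ((F⁻¹).map (algebraMap K A)) M 0 (d + 1))
      fun r hr => by
        rw [chain_succ_eq_extRight (by omega), MbarSeg_succ_eq_extRight (by omega), extRight_mul],
    zero_add, hσ _ h₁ (add_comm 1 d), qtrLast_mul_smul_one, MpowF, qtrLast_rfl]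

end CHN
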